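/- Lipschitz gradient of the smoothed function (part of Lemma on the smoothed function). If F : ℝ^D → ℝ is convex and M₂-Lipschitz with respect to the Euclidean norm, then F_γ is differentiable on ℝ^D and its gradient is Lipschitz with constant √D·M₂/γ: ‖∇F_γ(y) − ∇F_γ(x)‖ ≤ (√D·M₂/γ)·‖y − x‖ for all x, y ∈ ℝ^D. -/

import Mathlib

open MeasureTheory
open scoped ENNReal

noncomputable section

/-- The uniform probability distribution on the closed Euclidean unit ball of `ℝ^D`
(normalized restriction of Lebesgue measure). -/
def uniformBall (D : ℕ) : Measure (EuclideanSpace ℝ (Fin D)) :=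
  (volume (Metric.closedBall (0 : EuclideanSpace ℝ (Fin D)) 1))⁻¹ •
    volume.restrict (Metric.closedBall (0 : EuclideanSpace ℝ (Fin D)) 1)

/-- The smoothed function `F_γ(x) := E[F(x + γ ẽ)]`, with `ẽ` uniform on the closed
Euclidean unit ball. -/
def smoothed (D : ℕ) (F : EuclideanSpace ℝ (Fin D) → ℝ) (γ : ℝ)
    (x : EuclideanSpace ℝ (Fin D)) : ℝ :=
  ∫ u, F (x + γ • u) ∂(uniformBall D)

/-- The part of the unit ball left uncovered by the unit ball shifted by `t` along the first
coordinate axis. -/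
lemma volume_ball_diff_shift_axis_le (n : ℕ) {t : ℝ} (ht : 0 ≤ t) :
    volume (Metric.closedBall (0 : EuclideanSpace ℝ (Fin (n + 1))) 1 \
        Metric.closedBall (EuclideanSpace.single 0 t) 1) ≤
      ENNReal.ofReal t * volume (Metric.closedBall (0 : EuclideanSpace ℝ (Fin n)) 1) := by
  set T : Set (ℝ × (Fin n → ℝ)) :=
    {p | p.1 ^ 2 + ∑ i, p.2 i ^ 2 ≤ 1 ∧ 1 < (p.1 - t) ^ 2 + ∑ i, p.2 i ^ 2} with hT
  have hTm : MeasurableSet T :=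
    MeasurableSet.inter
      (measurableSet_le (f := fun p : ℝ × (Fin n → ℝ) => p.1 ^ 2 + ∑ i, p.2 i ^ 2)
        (by fun_prop) measurable_const)
      (measurableSet_lt (g := fun p : ℝ × (Fin n → ℝ) => (p.1 - t) ^ 2 + ∑ i, p.2 i ^ 2)
        measurable_const (by fun_prop))
  have hmp := (volume_preserving_piFinSuccAbove (fun _ : Fin (n + 1) => ℝ) 0).comp
    (EuclideanSpace.volume_preserving_symm_measurableEquiv_toLp (Fin (n + 1)))
  have hpre : Metric.closedBall (0 : EuclideanSpace ℝ (Fin (n + 1))) 1 \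
      Metric.closedBall (EuclideanSpace.single 0 t) 1 =
      (MeasurableEquiv.piFinSuccAbove (fun _ : Fin (n + 1) => ℝ) 0 ∘
        (MeasurableEquiv.toLp 2 (Fin (n + 1) → ℝ)).symm) ⁻¹' T := by
    ext z
    simp [hT, EuclideanSpace.dist_eq, Fin.sum_univ_succ, Real.dist_eq, sq_abs,
      Real.sqrt_le_one, Fin.tail, EuclideanSpace.norm_eq]
  have hm : MeasurableSet {y : Fin n → ℝ | ∑ i, y i ^ 2 ≤ 1} :=
    measurableSet_le (by fun_prop) measurable_const
  have hball : volume (Metric.closedBall (0 : EuclideanSpace ℝ (Fin n)) 1) =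
      volume {y : Fin n → ℝ | ∑ i, y i ^ 2 ≤ 1} := by
    rw [← (EuclideanSpace.volume_preserving_symm_measurableEquiv_toLp (Fin n)).measure_preimage
      hm.nullMeasurableSet]
    congr 1
    ext z
    simp [EuclideanSpace.norm_eq]
  rw [hpre, hmp.measure_preimage hTm.nullMeasurableSet, hball, Measure.volume_eq_prod,
    Measure.prod_apply_symm hTm]
  rw [← setLIntegral_const, ← lintegral_indicator hm]
  refine lintegral_mono fun y => ?_
  by_cases hy : ∑ i, y i ^ 2 ≤ 1
  · rw [Set.indicator_of_mem (by exact hy)]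
    set a := Real.sqrt (1 - ∑ i, y i ^ 2) with ha
    have ha2 : a ^ 2 = 1 - ∑ i, y i ^ 2 := Real.sq_sqrt (by linarith)
    have ha0 : 0 ≤ a := Real.sqrt_nonneg _
    calc volume ((fun s => (s, y)) ⁻¹' T) ≤ volume (Set.Ico (-a) (-a + t)) := by
          refine measure_mono fun s hs => ?_
          obtain ⟨h1, h2⟩ := hs
          simp only at h1 h2
          have h3 := abs_le_of_sq_le_sq' (show s ^ 2 ≤ a ^ 2 by linarith) ha0
          refine ⟨h3.1, ?_⟩
          by_contra! hcon
          nlinarith [h3.2]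
      _ = ENNReal.ofReal t := by rw [Real.volume_Ico]; congr 1; ring
  · rw [Set.indicator_of_notMem (by exact hy)]
    refine le_of_eq ?_
    convert measure_empty (μ := (volume : Measure ℝ))
    ext s
    simp only [Set.mem_preimage, Set.mem_empty_iff_false, iff_false]
    intro hs
    exact hy (by nlinarith [hs.1, sq_nonneg s])

lemma volume_ball_diff_shift_le (n : ℕ) (h : EuclideanSpace ℝ (Fin (n + 1))) :
    volume (Metric.closedBall (0 : EuclideanSpace ℝ (Fin (n + 1))) 1 \
        Metric.closedBall h 1) ≤
      ENNReal.ofReal ‖h‖ * volume (Metric.closedBall (0 : EuclideanSpace ℝ (Fin n)) 1) := by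
  set e : EuclideanSpace ℝ (Fin (n + 1)) := EuclideanSpace.single 0 ‖h‖ with he
  set R := (Submodule.span ℝ {h - e})ᗮ.reflection with hR
  have hRh : R h = e := Submodule.reflection_sub (by simp [he])
  have hpre : Metric.closedBall (0 : EuclideanSpace ℝ (Fin (n + 1))) 1 \ Metric.closedBall h 1 =
      R ⁻¹' (Metric.closedBall 0 1 \ Metric.closedBall e 1) := by
    ext z
    simp only [Set.mem_sdiff, Set.mem_preimage, Metric.mem_closedBall, ← hRh, R.dist_map,
      dist_zero_right, R.norm_map]
  rw [hpre, R.measurePreserving.measure_preimage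
    (Metric.isClosed_closedBall.measurableSet.diff
      Metric.isClosed_closedBall.measurableSet).nullMeasurableSet]
  exact volume_ball_diff_shift_axis_le n (norm_nonneg h)

lemma volume_real_unitBall (n : ℕ) :
    volume.real (Metric.closedBall (0 : EuclideanSpace ℝ (Fin n)) 1) =
      Real.sqrt Real.pi ^ n / Real.Gamma (n / 2 + 1) := by
  rcases Nat.eq_zero_or_pos n with rfl | hn
  · simp [volume_euclideanSpace_eq_dirac, Measure.real]
  · have : Nonempty (Fin n) := ⟨⟨0, hn⟩⟩
    have hG : 0 < Real.Gamma (n / 2 + 1) := Real.Gamma_pos_of_pos (by positivity)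
    rw [Measure.real, EuclideanSpace.volume_closedBall]
    simp only [Fintype.card_fin, ENNReal.ofReal_one, one_pow, one_mul]
    exact ENNReal.toReal_ofReal (by positivity)

lemma succ_mul_Gamma_half_sq_le (n : ℕ) :
    (n + 1 : ℝ) * Real.Gamma ((n + 1) / 2) ^ 2 ≤ Real.pi * Real.Gamma (n / 2 + 1) ^ 2 := by
  induction n using Nat.twoStepInduction with
  | zero =>
    have h1 := Real.Gamma_one_half_eq
    norm_num only [Nat.cast_zero, Real.Gamma_one] at h1 ⊢
    rw [h1, Real.sq_sqrt Real.pi_pos.le, one_mul, mul_one]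
  | one =>
    have h1 : Real.Gamma ((1 : ℝ) / 2 + 1) = 1 / 2 * Real.sqrt Real.pi := by
      rw [Real.Gamma_add_one (by norm_num), Real.Gamma_one_half_eq]
    norm_num only [Nat.cast_one] at h1 ⊢
    rw [h1, Real.Gamma_one, mul_pow, Real.sq_sqrt Real.pi_pos.le]
    nlinarith [Real.pi_gt_three]
  | more n ih _ =>
    have h1 : Real.Gamma (((n + 2 : ℕ) + 1) / 2) = (n + 1) / 2 * Real.Gamma ((n + 1) / 2) := by
      rw [← Real.Gamma_add_one (by positivity)]
      congr 1; push_cast; ring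
    have h2 : Real.Gamma ((n + 2 : ℕ) / 2 + 1) = (n + 2) / 2 * Real.Gamma (n / 2 + 1) := by
      rw [show (n + 2 : ℝ) / 2 = n / 2 + 1 by ring, ← Real.Gamma_add_one (by positivity)]
      congr 1; push_cast; ring
    rw [h1, h2]
    push_cast
    set A := Real.Gamma ((n + 1) / 2) ^ 2 with hA
    have hA0 : 0 ≤ A := sq_nonneg _
    have h3 := mul_le_mul_of_nonneg_left ih (show (0 : ℝ) ≤ ((n + 2) / 2) ^ 2 by positivity)
    have h4 : 0 ≤ A * (n + 1) := by positivity
    rw [mul_pow, mul_pow]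
    nlinarith

/-- The Gamma-function inequality comparing the volumes of consecutive unit balls. -/
lemma two_mul_volume_unitBall_le (n : ℕ) :
    2 * volume.real (Metric.closedBall (0 : EuclideanSpace ℝ (Fin n)) 1) ≤
      Real.sqrt (n + 1 : ℕ) *
        volume.real (Metric.closedBall (0 : EuclideanSpace ℝ (Fin (n + 1))) 1) := by
  have hG1 : 0 < Real.Gamma (n / 2 + 1) := Real.Gamma_pos_of_pos (by positivity)
  have hG2 : 0 < Real.Gamma ((n + 1) / 2 : ℝ) := Real.Gamma_pos_of_pos (by positivity)
  have hs : Real.sqrt (n + 1) ^ 2 = n + 1 := Real.sq_sqrt (by positivity)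
  have hs0 : 0 < Real.sqrt (n + 1) := Real.sqrt_pos.2 (by positivity)
  have hp : 0 < Real.sqrt Real.pi := Real.sqrt_pos.2 Real.pi_pos
  have key : Real.sqrt (n + 1) * Real.Gamma ((n + 1) / 2) ≤
      Real.sqrt Real.pi * Real.Gamma (n / 2 + 1) := by
    refine le_of_sq_le_sq ?_ (by positivity)
    rw [mul_pow, mul_pow, hs, Real.sq_sqrt Real.pi_pos.le]
    exact succ_mul_Gamma_half_sq_le n
  rw [volume_real_unitBall, volume_real_unitBall]
  push_cast
  rw [Real.Gamma_add_one (by positivity : ((n : ℝ) + 1) / 2 ≠ 0), ← mul_div_assoc,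
    ← mul_div_assoc, div_le_div_iff₀ hG1 (by positivity), pow_succ]
  have h5 := mul_le_mul_of_nonneg_left key
    (show 0 ≤ Real.sqrt Real.pi ^ n * Real.sqrt (n + 1) by positivity)
  calc _ = Real.sqrt Real.pi ^ n * Real.sqrt (n + 1) *
        (Real.sqrt (n + 1) * Real.Gamma ((n + 1) / 2)) := by
        linear_combination (-(Real.sqrt Real.pi ^ n * Real.Gamma ((n + 1) / 2))) * hs
    _ ≤ _ := h5
    _ = _ := by ring

lemma volume_real_ball_diff_ball_le (n : ℕ) (x y : EuclideanSpace ℝ (Fin (n + 1))) :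
    volume.real (Metric.closedBall x 1 \ Metric.closedBall y 1) ≤
      ‖y - x‖ * volume.real (Metric.closedBall (0 : EuclideanSpace ℝ (Fin n)) 1) := by
  have hpre : Metric.closedBall (0 : EuclideanSpace ℝ (Fin (n + 1))) 1 \
      Metric.closedBall (y - x) 1 =
      (fun z => x + z) ⁻¹' (Metric.closedBall x 1 \ Metric.closedBall y 1) := by
    ext z
    simp [dist_eq_norm, sub_sub_eq_add_sub, add_comm]
  have h := volume_ball_diff_shift_le n (y - x)
  rw [hpre, measure_preimage_add] at h
  have h' := ENNReal.toReal_mono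
    (ENNReal.mul_ne_top ENNReal.ofReal_ne_top measure_closedBall_lt_top.ne) h
  rwa [ENNReal.toReal_mul, ENNReal.toReal_ofReal (norm_nonneg _)] at h'

/-- The integrals of a bounded function over two unit balls differ by at most a multiple of the
distance between the centres. -/
lemma norm_setIntegral_ball_sub_le {n : ℕ} {V : Type*} [NormedAddCommGroup V] [NormedSpace ℝ V]
    {k : EuclideanSpace ℝ (Fin (n + 1)) → V} (hk : AEStronglyMeasurable k volume) {M : ℝ}
    (hM : ∀ z, ‖k z‖ ≤ M) (x y : EuclideanSpace ℝ (Fin (n + 1))) :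
    ‖(∫ z in Metric.closedBall y 1, k z) - ∫ z in Metric.closedBall x 1, k z‖ ≤
      Real.sqrt (n + 1 : ℕ) * M * ‖y - x‖ *
        volume.real (Metric.closedBall (0 : EuclideanSpace ℝ (Fin (n + 1))) 1) := by
  have hM0 : 0 ≤ M := (norm_nonneg _).trans (hM 0)
  have hint : ∀ z, IntegrableOn k (Metric.closedBall z 1) volume := fun z =>
    Measure.integrableOn_of_bounded measure_closedBall_lt_top.ne hk (ae_of_all _ hM)
  have hx := integral_inter_add_sdiff (s := Metric.closedBall x 1)
    (t := Metric.closedBall y 1) Metric.isClosed_closedBall.measurableSet (hint x)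
  have hy := integral_inter_add_sdiff (s := Metric.closedBall y 1)
    (t := Metric.closedBall x 1) Metric.isClosed_closedBall.measurableSet (hint y)
  have hb : ∀ u v : EuclideanSpace ℝ (Fin (n + 1)),
      ‖∫ z in Metric.closedBall u 1 \ Metric.closedBall v 1, k z‖ ≤
        M * (‖v - u‖ * volume.real (Metric.closedBall (0 : EuclideanSpace ℝ (Fin n)) 1)) :=
    fun u v => (norm_setIntegral_le_of_norm_le_const
      ((measure_mono Set.sdiff_subset).trans_lt measure_closedBall_lt_top)
      fun z _ => hM z).trans
        (mul_le_mul_of_nonneg_left (volume_real_ball_diff_ball_le n u v) hM0)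
  rw [← hx, ← hy, Set.inter_comm, add_sub_add_left_eq_sub]
  refine (norm_sub_le _ _).trans ((add_le_add (hb y x) (hb x y)).trans ?_)
  rw [norm_sub_rev x y]
  have := mul_le_mul_of_nonneg_left (two_mul_volume_unitBall_le n)
    (mul_nonneg hM0 (norm_nonneg (y - x)))
  linarith

instance isProbabilityMeasure_uniformBall (D : ℕ) : IsProbabilityMeasure (uniformBall D) := by
  refine ⟨?_⟩
  rw [uniformBall, Measure.smul_apply, Measure.restrict_apply_univ, smul_eq_mul]
  exact ENNReal.inv_mul_cancel (Metric.measure_closedBall_pos _ _ one_pos).ne'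
    measure_closedBall_lt_top.ne

lemma uniformBall_absolutelyContinuous (D : ℕ) : uniformBall D ≪ volume :=
  (Measure.smul_absolutelyContinuous).trans Measure.absolutelyContinuous_restrict

lemma uniformBall_ae_norm_le (D : ℕ) : ∀ᵐ u ∂(uniformBall D), ‖u‖ ≤ 1 := by
  refine (Measure.smul_absolutelyContinuous) ?_
  filter_upwards [ae_restrict_mem Metric.isClosed_closedBall.measurableSet] with u hu
  simpa using hu

lemma ae_uniformBall_comp {D : ℕ} {γ : ℝ} (hγ : 0 < γ)
    {p : EuclideanSpace ℝ (Fin D) → Prop} (hp : ∀ᵐ z, p z) (x : EuclideanSpace ℝ (Fin D)) :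
    ∀ᵐ u ∂(uniformBall D), p (x + γ • u) := by
  refine uniformBall_absolutelyContinuous D ?_
  have h1 : ∀ᵐ z, p (x + z) := (measurePreserving_add_left volume x).quasiMeasurePreserving.ae hp
  exact (Measure.quasiMeasurePreserving_smul volume hγ.ne').ae h1

lemma hasFDerivAt_smoothed {D : ℕ} {γ : ℝ} (hγ : 0 < γ) {F : EuclideanSpace ℝ (Fin D) → ℝ}
    {C : NNReal} (hF : LipschitzWith C F) (x : EuclideanSpace ℝ (Fin D)) :
    HasFDerivAt (smoothed D F γ) (∫ u, fderiv ℝ F (x + γ • u) ∂(uniformBall D)) x := by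
  have hcont : ∀ x : EuclideanSpace ℝ (Fin D), Continuous fun u => F (x + γ • u) := fun x =>
    hF.continuous.comp (by fun_prop)
  refine (hasFDerivAt_integral_of_dominated_loc_of_lip (s := Set.univ) (bound := fun _ => (C : ℝ))
    Filter.univ_mem (Filter.Eventually.of_forall fun x => (hcont x).aestronglyMeasurable)
    ?_ ?_ ?_ (integrable_const _) ?_).2
  · refine Integrable.of_bound (hcont x).aestronglyMeasurable (|F x| + C * γ) ?_
    filter_upwards [uniformBall_ae_norm_le D] with u hu
    have h1 := hF.norm_sub_le (x + γ • u) x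
    rw [add_sub_cancel_left, norm_smul, Real.norm_of_nonneg hγ.le] at h1
    have h2 := norm_le_norm_add_norm_sub (F x) (F (x + γ • u))
    rw [norm_sub_rev, Real.norm_eq_abs (F x)] at h2
    have h3 : (C : ℝ) * (γ * ‖u‖) ≤ C * γ := by
      gcongr
      nlinarith
    linarith
  · exact ((measurable_fderiv ℝ F).comp (by fun_prop)).aestronglyMeasurable
  · refine ae_of_all _ fun u => LipschitzWith.lipschitzOnWith ?_
    simpa [Function.comp_def] using hF.comp (LipschitzWith.id.add (LipschitzWith.const (γ • u)))
  · filter_upwards [ae_uniformBall_comp hγ hF.ae_differentiableAt x] with u hu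
    exact (hasFDerivAt_comp_add_right (γ • u)).2 hu.hasFDerivAt

lemma norm_integral_uniformBall_sub_le {D : ℕ} (hD : 0 < D) {γ : ℝ} (hγ : 0 < γ)
    {V : Type*} [NormedAddCommGroup V] [NormedSpace ℝ V] [MeasurableSpace V] [BorelSpace V]
    [SecondCountableTopology V] {g : EuclideanSpace ℝ (Fin D) → V} (hg : Measurable g) {M : ℝ}
    (hM : ∀ z, ‖g z‖ ≤ M) (x y : EuclideanSpace ℝ (Fin D)) :
    ‖(∫ u, g (y + γ • u) ∂(uniformBall D)) - ∫ u, g (x + γ • u) ∂(uniformBall D)‖ ≤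
      Real.sqrt D * M / γ * ‖y - x‖ := by
  obtain ⟨n, rfl⟩ : ∃ n, D = n + 1 := ⟨D - 1, by omega⟩
  set k : EuclideanSpace ℝ (Fin (n + 1)) → V := fun v => g (γ • v) with hk
  have hkm : Measurable k := hg.comp (by fun_prop)
  have hrw : ∀ w : EuclideanSpace ℝ (Fin (n + 1)),
      ∫ u, g (w + γ • u) ∂(uniformBall (n + 1)) =
        (volume.real (Metric.closedBall (0 : EuclideanSpace ℝ (Fin (n + 1))) 1))⁻¹ •
          ∫ v in Metric.closedBall (γ⁻¹ • w) 1, k v := fun w => by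
    rw [uniformBall, integral_smul_measure, ENNReal.toReal_inv, ← Measure.real,
      ← (measurePreserving_add_left volume (γ⁻¹ • w)).setIntegral_preimage_emb
        (measurableEmbedding_addLeft _) k]
    congr 2
    · congr 1
      ext z
      simp [dist_eq_norm]
    · ext u
      simp [hk, smul_smul, hγ.ne']
  have hV : 0 < volume.real (Metric.closedBall (0 : EuclideanSpace ℝ (Fin (n + 1))) 1) :=
    ENNReal.toReal_pos (Metric.measure_closedBall_pos _ _ one_pos).ne'
      measure_closedBall_lt_top.ne
  rw [hrw, hrw, ← smul_sub, norm_smul, norm_inv, Real.norm_of_nonneg hV.le, inv_mul_le_iff₀ hV]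
  refine (norm_setIntegral_ball_sub_le hkm.aestronglyMeasurable (fun z => hM _) _ _).trans_eq ?_
  rw [← smul_sub, norm_smul, norm_inv, Real.norm_of_nonneg hγ.le]
  ring

/-- Lipschitz gradient of the smoothed function: if `F : ℝ^D → ℝ` is convex and
`M₂`-Lipschitz in the Euclidean norm, then `F_γ` is differentiable on `ℝ^D` and its
gradient is Lipschitz with constant `√D·M₂/γ`. -/
theorem smoothed_gradient_lipschitz
    (D : ℕ) (hD : 0 < D) (γ : ℝ) (hγ : 0 < γ)
    (F : EuclideanSpace ℝ (Fin D) → ℝ) (M₂ : ℝ)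
    (hconv : ConvexOn ℝ Set.univ F)
    (hlip : ∀ x y : EuclideanSpace ℝ (Fin D), |F y - F x| ≤ M₂ * ‖y - x‖) :
    Differentiable ℝ (smoothed D F γ) ∧
      ∀ x y : EuclideanSpace ℝ (Fin D),
        ‖gradient (smoothed D F γ) y - gradient (smoothed D F γ) x‖ ≤
          Real.sqrt D * M₂ / γ * ‖y - x‖ := by
  have hM : 0 ≤ M₂ := by
    have h := (abs_nonneg _).trans (hlip 0 (EuclideanSpace.single ⟨0, hD⟩ 1))
    simpa using h
  have hF : LipschitzWith M₂.toNNReal F := LipschitzWith.of_dist_le_mul fun x y => by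
    rw [Real.coe_toNNReal _ hM, dist_eq_norm, dist_eq_norm, Real.norm_eq_abs]
    exact hlip y x
  refine ⟨fun x => (hasFDerivAt_smoothed hγ hF x).differentiableAt, fun x y => ?_⟩
  rw [gradient, gradient, ← map_sub, LinearIsometryEquiv.norm_map,
    (hasFDerivAt_smoothed hγ hF x).fderiv, (hasFDerivAt_smoothed hγ hF y).fderiv]
  refine norm_integral_uniformBall_sub_le hD hγ (measurable_fderiv ℝ F) (fun z => ?_) x y
  simpa [Real.coe_toNNReal _ hM] using norm_fderiv_le_of_lipschitz ℝ hF (x₀ := z)
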